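/- arXiv:1708.09162 — 3 statements merged into one kernel-verified Lean document; each statement's English description precedes it below -/
import Mathlib

section
/- For every fixed point y in ℝ³, every real wavenumber κ, and every x in ℝ³ with x ≠ y, the Helmholtz fundamental solution u*(x,y) = exp(iκ‖x−y‖)/(4π‖x−y‖) is, as a function of x, infinitely differentiable on ℝ³ \ {y} and satisfies the Helmholtz equation Δu* + κ²u* = 0 at every x ≠ y, where the Laplacian is taken in the x variable. -/
/-- The Helmholtz fundamental solution in three dimensions with wavenumber `κ`,
`u*(x, y) = exp(i κ ‖x - y‖) / (4 π ‖x - y‖)`, viewed as a function of `x` for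
fixed `y`. -/
noncomputable def helmholtzKernel (κ : ℝ) (y x : EuclideanSpace ℝ (Fin 3)) : ℂ :=
  Complex.exp (Complex.I * κ * ‖x - y‖) / (4 * Real.pi * ‖x - y‖ : ℝ)

/-- The Laplacian of a function `f : ℝ³ → ℂ` at a point `x`, i.e.
`∑_{k=1}^{3} ∂² f / ∂ x_k²` evaluated via iterated (Fréchet) derivatives in the
coordinate directions. -/
noncomputable def laplacianC (f : EuclideanSpace ℝ (Fin 3) → ℂ)
    (x : EuclideanSpace ℝ (Fin 3)) : ℂ :=
  ∑ k : Fin 3,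
    fderiv ℝ (fun z => fderiv ℝ f z (EuclideanSpace.single k (1 : ℝ))) x
      (EuclideanSpace.single k (1 : ℝ))

/-- The derivative of `z ↦ ‖z - y‖` away from `y`. -/
theorem hasFDerivAt_norm_sub {E : Type*} [NormedAddCommGroup E] [InnerProductSpace ℝ E]
    {x y : E} (h : x ≠ y) :
    HasFDerivAt (fun z => ‖z - y‖) (‖x - y‖⁻¹ • innerSL ℝ (x - y)) x := by
  have hr : ‖x - y‖ ≠ 0 := norm_ne_zero_iff.mpr (sub_ne_zero.mpr h)
  have h1 := ((hasFDerivAt_id (𝕜 := ℝ) x).sub_const y).norm_sq.sqrt (pow_ne_zero 2 hr)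
  simp only [id, Real.sqrt_sq (norm_nonneg _)] at h1
  refine h1.congr_fderiv ?_
  ext v
  simp
  field_simp

/-- The directional derivative of a radial function. -/
theorem HasDerivAt.hasFDerivAt_comp_norm_sub {E F : Type*} [NormedAddCommGroup E]
    [InnerProductSpace ℝ E] [NormedAddCommGroup F] [NormedSpace ℝ F] {x y : E} (h : x ≠ y)
    {g : ℝ → F} {g' : F} (hg : HasDerivAt g g' ‖x - y‖) :
    HasFDerivAt (fun z => g ‖z - y‖)
      ((‖x - y‖⁻¹ • innerSL ℝ (x - y)).smulRight g') x := by
  refine (hg.hasFDerivAt.comp x (hasFDerivAt_norm_sub h)).congr_fderiv ?_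
  ext v
  simp [← sub_smul, mul_smul]

/-- The Laplacian of a radial function `g(‖x - y‖)` whose profile satisfies `g'(r) = r h(r)`. -/
theorem laplacianC_comp_norm_sub {g h : ℝ → ℂ} {h' : ℂ} {x y : EuclideanSpace ℝ (Fin 3)}
    (hxy : x ≠ y) (hg : ∀ r : ℝ, 0 < r → HasDerivAt g (r * h r) r)
    (hh : HasDerivAt h h' ‖x - y‖) :
    laplacianC (fun z => g ‖z - y‖) x = 3 * h ‖x - y‖ + ‖x - y‖ * h' := by
  have hpos {z : EuclideanSpace ℝ (Fin 3)} (hz : z ≠ y) : 0 < ‖z - y‖ :=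
    norm_pos_iff.mpr (sub_ne_zero.mpr hz)
  have hr : (‖x - y‖ : ℂ) ≠ 0 := by exact_mod_cast (hpos hxy).ne'
  have second (k : Fin 3) :
      fderiv ℝ (fun z => fderiv ℝ (fun z => g ‖z - y‖) z (EuclideanSpace.single k (1 : ℝ))) x
        (EuclideanSpace.single k (1 : ℝ)) =
      h ‖x - y‖ + ((x k - y k : ℝ) : ℂ) ^ 2 * ((‖x - y‖ : ℂ)⁻¹ * h') := by
    have first : (fun z => fderiv ℝ (fun z => g ‖z - y‖) z (EuclideanSpace.single k (1 : ℝ)))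
        =ᶠ[nhds x] fun z => innerSL ℝ (EuclideanSpace.single k (1 : ℝ)) (z - y) • h ‖z - y‖ := by
      filter_upwards [isOpen_ne.mem_nhds hxy] with z hz
      have hz' : (‖z - y‖ : ℂ) ≠ 0 := by exact_mod_cast (hpos hz).ne'
      rw [((hg _ (hpos hz)).hasFDerivAt_comp_norm_sub hz).fderiv]
      simp [EuclideanSpace.inner_single_left, EuclideanSpace.inner_single_right]
      field_simp
    have hlin := (innerSL ℝ (EuclideanSpace.single k (1 : ℝ))).hasFDerivAt.comp x
      ((hasFDerivAt_id (𝕜 := ℝ) x).sub_const y)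
    have hprod := hlin.smul (hh.hasFDerivAt_comp_norm_sub hxy)
    rw [first.fderiv_eq]
    erw [hprod.fderiv]
    simp [EuclideanSpace.inner_single_left, EuclideanSpace.inner_single_right]
    ring
  have hsum : ∑ k : Fin 3, ((x k - y k : ℝ) : ℂ) ^ 2 = (‖x - y‖ : ℂ) ^ 2 := by
    have := EuclideanSpace.real_norm_sq_eq (x - y)
    exact_mod_cast this.symm
  simp only [laplacianC, second, Finset.sum_add_distrib, ← Finset.sum_mul, hsum]
  simp
  field_simp

theorem contDiffOn_helmholtzKernel (κ : ℝ) (y : EuclideanSpace ℝ (Fin 3)) {n : WithTop ℕ∞} :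
    ContDiffOn ℝ n (helmholtzKernel κ y) {y}ᶜ := by
  intro x hx
  have hxy : x - y ≠ 0 := sub_ne_zero.mpr hx
  have hnorm : ContDiffAt ℝ n (fun z : EuclideanSpace ℝ (Fin 3) => ‖z - y‖) x :=
    (contDiffAt_id.sub contDiffAt_const).norm ℝ hxy
  have hcast : ContDiffAt ℝ n (fun z : EuclideanSpace ℝ (Fin 3) => (‖z - y‖ : ℂ)) x :=
    Complex.ofRealCLM.contDiff.contDiffAt.comp x hnorm
  have hden : ContDiffAt ℝ n
      (fun z : EuclideanSpace ℝ (Fin 3) => ((4 * Real.pi * ‖z - y‖ : ℝ) : ℂ)) x :=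
    Complex.ofRealCLM.contDiff.contDiffAt.comp x (contDiffAt_const.mul hnorm)
  have hne : ((4 * Real.pi * ‖x - y‖ : ℝ) : ℂ) ≠ 0 := by
    simp [hxy, Real.pi_ne_zero]
  have hexp := (contDiffAt_const (c := Complex.I * κ)).mul hcast |>.cexp
  exact (hexp.mul (hden.inv hne)).contDiffWithinAt

/-- For every fixed `y ∈ ℝ³` and real wavenumber `κ`, the Helmholtz fundamental
solution `x ↦ exp(iκ‖x - y‖)/(4π‖x - y‖)` is infinitely differentiable on
`ℝ³ \ {y}` and satisfies the Helmholtz equation `Δu* + κ²u* = 0` at every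
`x ≠ y`. -/
theorem helmholtz_fundamental_solution_smooth_and_helmholtz
    (y : EuclideanSpace ℝ (Fin 3)) (κ : ℝ) :
    ContDiffOn ℝ (⊤ : ℕ∞) (helmholtzKernel κ y) {y}ᶜ ∧
      ∀ x : EuclideanSpace ℝ (Fin 3), x ≠ y →
        laplacianC (helmholtzKernel κ y) x + (κ : ℂ) ^ 2 * helmholtzKernel κ y x = 0 := by
  refine ⟨contDiffOn_helmholtzKernel κ y, fun x hx => ?_⟩
  have hr : 0 < ‖x - y‖ := norm_pos_iff.mpr (sub_ne_zero.mpr hx)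
  have hpi : (Real.pi : ℂ) ≠ 0 := by exact_mod_cast Real.pi_ne_zero
  have hexp (r : ℝ) : HasDerivAt (fun r : ℝ => Complex.exp (Complex.I * κ * r))
      (Complex.exp (Complex.I * κ * r) * (Complex.I * κ)) r := by
    simpa using ((Complex.ofRealCLM.hasDerivAt (x := r)).const_mul (Complex.I * κ)).cexp
  have hg (r : ℝ) (hr : 0 < r) :
      HasDerivAt (fun r : ℝ => Complex.exp (Complex.I * κ * r) / (4 * Real.pi * r : ℝ))
        (r * (Complex.exp (Complex.I * κ * r) * (Complex.I * κ * r - 1) /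
          (4 * Real.pi * r ^ 3))) r := by
    have hr' : (r : ℂ) ≠ 0 := by exact_mod_cast hr.ne'
    have hden : HasDerivAt (fun r : ℝ => ((4 * Real.pi * r : ℝ) : ℂ)) (4 * Real.pi) r := by
      simpa using ((hasDerivAt_id r).const_mul (4 * Real.pi)).ofReal_comp
    refine ((hexp r).div hden (by simp [hr.ne', Real.pi_ne_zero])).congr_deriv ?_
    push_cast
    field_simp
  have hh (r : ℝ) (hr : 0 < r) :
      HasDerivAt (fun r : ℝ => Complex.exp (Complex.I * κ * r) * (Complex.I * κ * r - 1) /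
          (4 * Real.pi * r ^ 3))
        (Complex.exp (Complex.I * κ * r) * (3 - 3 * Complex.I * κ * r - κ ^ 2 * r ^ 2) /
          (4 * Real.pi * r ^ 4)) r := by
    have hr' : (r : ℂ) ≠ 0 := by exact_mod_cast hr.ne'
    have hid : HasDerivAt (fun r : ℝ => (r : ℂ)) 1 r := Complex.ofRealCLM.hasDerivAt
    refine (((hexp r).mul ((hid.const_mul (Complex.I * κ)).sub_const 1)).div
      ((hid.pow 3).const_mul (4 * Real.pi : ℂ)) (by simp [hr.ne', Real.pi_ne_zero])).congr_deriv ?_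
    simp only [Pi.mul_apply, Pi.pow_apply]
    field_simp
    ring_nf
    simp only [Complex.I_sq]
    ring
  have hr' : (‖x - y‖ : ℂ) ≠ 0 := by exact_mod_cast hr.ne'
  have hlap := laplacianC_comp_norm_sub hx hg (hh _ hr)
  change laplacianC (fun z => Complex.exp (Complex.I * κ * ‖z - y‖) /
    (4 * Real.pi * ‖z - y‖ : ℝ)) x + _ * (_ / _) = 0
  rw [hlap]
  push_cast
  field_simp
  ring
end

section
/- Let Ξ = [ξ_0, …, ξ_{k+p}] be a p-open knot vector and let b_j^p, 0 ≤ j < k, be the B-spline basis functions defined by the Cox–de Boor recursion. Then the basis functions form a partition of unity on [0,1): for every x with 0 ≤ x < 1, ∑_{j=0}^{k−1} b_j^p(x) = 1. -/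
/-- The B-spline basis functions `b_j^p` associated to the knot sequence `ξ`,
defined by the Cox–de Boor recursion, with the convention that any term whose
denominator vanishes is taken to be zero. `bspline ξ p j x = b_j^p(x)`. -/
noncomputable def bspline (ξ : ℕ → ℝ) : ℕ → ℕ → ℝ → ℝ
  | 0, j, x => if ξ j ≤ x ∧ x < ξ (j + 1) then 1 else 0
  | p + 1, j, x =>
      (if ξ (j + p + 1) = ξ j then 0
        else (x - ξ j) / (ξ (j + p + 1) - ξ j) * bspline ξ p j x) +
      (if ξ (j + p + 2) = ξ (j + 1) then 0
        else (ξ (j + p + 2) - x) / (ξ (j + p + 2) - ξ (j + 1)) * bspline ξ p (j + 1) x)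

/-- `ξ` is a `p`-open knot vector with `k` basis functions: a nondecreasing
sequence `ξ_0, …, ξ_{k+p}` in `[0,1]` with `ξ_0 = ⋯ = ξ_p = 0` and
`ξ_k = ⋯ = ξ_{k+p} = 1`, where `p ≤ k`. -/
def IsOpenKnotVector (ξ : ℕ → ℝ) (p k : ℕ) : Prop :=
  p ≤ k ∧ (∀ i, i < k + p → ξ i ≤ ξ (i + 1)) ∧
    (∀ i, i ≤ p → ξ i = 0) ∧ (∀ i, k ≤ i → i ≤ k + p → ξ i = 1)


theorem le_of_forall_le_succ_of_lt {ξ : ℕ → ℝ} {n : ℕ}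
    (hξ : ∀ i, i < n → ξ i ≤ ξ (i + 1)) {a b : ℕ} (hab : a ≤ b) (hb : b ≤ n) :
    ξ a ≤ ξ b := by
  induction b, hab using Nat.le_induction with
  | base => exact le_rfl
  | succ m _ ih => exact (ih (by omega)).trans (hξ m (by omega))

theorem bspline_eq_zero_of_knots_eq {ξ : ℕ → ℝ} {n : ℕ}
    (hξ : ∀ i, i < n → ξ i ≤ ξ (i + 1)) {q j : ℕ} (hn : j + q + 1 ≤ n)
    (h : ξ (j + q + 1) = ξ j) (x : ℝ) : bspline ξ q j x = 0 := by
  cases q with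
  | zero =>
    rw [bspline, if_neg]
    rintro ⟨h₁, h₂⟩
    rw [add_zero] at h
    linarith
  | succ q =>
    have e : ξ (j + q + 2) = ξ j := h
    have h₁ := le_of_forall_le_succ_of_lt hξ (a := j) (b := j + 1) (by omega) (by omega)
    have h₂ := le_of_forall_le_succ_of_lt hξ (a := j + 1) (b := j + q + 1) (by omega) (by omega)
    have h₃ := le_of_forall_le_succ_of_lt hξ (a := j + q + 1) (b := j + q + 2)
      (by omega) (by omega)
    rw [bspline, if_pos (by linarith), if_pos (by linarith), add_zero]

theorem sum_range_bspline_zero {ξ : ℕ → ℝ} {n : ℕ}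
    (hξ : ∀ i, i < n → ξ i ≤ ξ (i + 1)) {x : ℝ} (hx : ξ 0 ≤ x) :
    ∑ j ∈ Finset.range n, bspline ξ 0 j x = if x < ξ n then 1 else 0 := by
  induction n with
  | zero => simp [hx]
  | succ n ih =>
    rw [Finset.sum_range_succ, ih fun i hi => hξ i (by omega), bspline]
    have := hξ n (by omega)
    split_ifs <;> grind

/-- Raising the degree by one preserves the sum of the basis functions, provided the first and
the last basis function of the lower degree have collapsed knot spans. -/
theorem sum_range_bspline_succ {ξ : ℕ → ℝ} {m q : ℕ}
    (hξ : ∀ i, i < m + q + 1 → ξ i ≤ ξ (i + 1)) (h₀ : ξ (q + 1) = ξ 0)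
    (h₁ : ξ (m + q + 1) = ξ m) (x : ℝ) :
    ∑ j ∈ Finset.range m, bspline ξ (q + 1) j x =
      ∑ j ∈ Finset.range (m + 1), bspline ξ q j x := by
  let A : ℕ → ℝ := fun j => if ξ (j + q + 1) = ξ j then 0
    else (x - ξ j) / (ξ (j + q + 1) - ξ j) * bspline ξ q j x
  let B : ℕ → ℝ := fun j => if ξ (j + q + 1) = ξ j then 0
    else (ξ (j + q + 1) - x) / (ξ (j + q + 1) - ξ j) * bspline ξ q j x
  have hrec : ∀ j, bspline ξ (q + 1) j x = A j + B (j + 1) := fun j => by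
    rw [bspline]
    simp only [A, B, show j + 1 + q + 1 = j + q + 2 by omega]
  have hsplit : ∀ j ∈ Finset.range (m + 1), bspline ξ q j x = A j + B j := fun j hj => by
    rw [Finset.mem_range] at hj
    by_cases h : ξ (j + q + 1) = ξ j
    · simp [A, B, h, bspline_eq_zero_of_knots_eq hξ (by omega) h]
    · have := sub_ne_zero.mpr h
      simp only [A, B, if_neg h]
      field_simp
      ring
  have hA : A m = 0 := if_pos h₁
  have hB : B 0 = 0 := if_pos (by rw [zero_add, h₀])
  rw [Finset.sum_congr rfl hsplit, Finset.sum_congr rfl fun j _ => hrec j,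
    Finset.sum_add_distrib, Finset.sum_add_distrib, Finset.sum_range_succ A,
    Finset.sum_range_succ' B, hA, hB, add_zero, add_zero]

/-- Partition of unity: the B-spline basis functions of a `p`-open knot vector
sum to one on `[0,1)`: for every `x` with `0 ≤ x < 1`,
`∑_{j=0}^{k-1} b_j^p(x) = 1`. -/
theorem bspline_partition_of_unity
    (ξ : ℕ → ℝ) (p k : ℕ) (hΞ : IsOpenKnotVector ξ p k) :
    ∀ x : ℝ, 0 ≤ x → x < 1 → ∑ j ∈ Finset.range k, bspline ξ p j x = 1 := by
  intro x hx₀ hx₁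
  obtain ⟨-, hmono, hzero, hone⟩ := hΞ
  have key : ∀ q m, m + q = k + p → q ≤ p →
      ∑ j ∈ Finset.range m, bspline ξ q j x = 1 := by
    intro q
    induction q with
    | zero =>
      intro m hm _
      rw [sum_range_bspline_zero (fun i hi => hmono i (by omega)) (by rwa [hzero 0 (by omega)]),
        if_pos (by rwa [hone m (by omega) (by omega)])]
    | succ q ih =>
      intro m hm hq
      rw [sum_range_bspline_succ (fun i hi => hmono i (by omega))
        (by rw [hzero _ hq, hzero 0 (by omega)])
        (by rw [hone _ (by omega) (by omega), hone m (by omega) (by omega)])]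
      exact ih (m + 1) (by omega) (by omega)
  exact key p k rfl le_rfl
end

section
/- Let p ≥ 0 and m ≥ 0 and let Ξ_{p,m} be the uniform p-open knot vector whose interior knots are 1/2^m, 2/2^m, …, (2^m − 1)/2^m, each appearing once, and whose boundary knots 0 and 1 each appear p+1 times. Then the 2^m + p B-spline basis functions b_0^p, …, b_{2^m+p−1}^p of degree p associated with Ξ_{p,m} are linearly independent as functions on [0,1); in particular the spline space S_p(Ξ_{p,m}) they span has dimension 2^m + p. -/
/-- The uniform `p`-open knot vector `Ξ_{p,m}` of refinement level `m`: the
boundary knots `0` and `1` each appear `p+1` times and the interior knots are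
`1/2^m, …, (2^m - 1)/2^m`, each appearing once (so `k = 2^m + p`). -/
noncomputable def uniformKnots (p m : ℕ) (i : ℕ) : ℝ :=
  if i ≤ p then 0 else if 2 ^ m + p ≤ i then 1 else ((i : ℝ) - p) / 2 ^ m

theorem bspline_eq_zero_of_lt {ξ : ℕ → ℝ} (hξ : Monotone ξ) (q j : ℕ) {x : ℝ} (hx : x < ξ j) :
    bspline ξ q j x = 0 := by
  induction q generalizing j with
  | zero => simp [bspline, hx]
  | succ q ih =>
    simp [bspline, ih j hx, ih (j + 1) (hx.trans_le (hξ j.le_succ))]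

theorem bspline_pos_of_mem_Ioo {ξ : ℕ → ℝ} (hξ : Monotone ξ) (q j : ℕ) {x : ℝ}
    (hx : x ∈ Set.Ioo (ξ j) (ξ (j + 1))) : 0 < bspline ξ q j x := by
  induction q with
  | zero => simp [bspline, hx.1.le, hx.2]
  | succ q ih =>
    have h : ξ j < ξ (j + q + 1) := (hx.1.trans hx.2).trans_le (hξ (by omega))
    simp only [bspline, bspline_eq_zero_of_lt hξ q (j + 1) hx.2, h.ne', if_false, mul_zero,
      ite_self, add_zero]
    exact mul_pos (div_pos (sub_pos.2 hx.1) (sub_pos.2 h)) ih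

/-- Near a knot `0` that is repeated up to index `p`, the B-spline `b_j^q` vanishes to order
exactly `j + q - p`. -/
theorem exists_bspline_eq_pow_mul {ξ : ℕ → ℝ} (hξ : Monotone ξ) {p : ℕ}
    (h_zero : ∀ i ≤ p, ξ i = 0) (h_pos : 0 < ξ (p + 1)) (q j i : ℕ) (hj : j ≤ p)
    (hi : j + q = p + i) :
    ∃ g : ℝ → ℝ, Continuous g ∧ 0 < g 0 ∧
      ∀ x ∈ Set.Ico 0 (ξ (p + 1)), bspline ξ q j x = x ^ i * g x := by
  induction q generalizing j i with
  | zero =>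
    obtain rfl : j = p := by omega
    obtain rfl : i = 0 := by omega
    refine ⟨fun _ => 1, continuous_const, one_pos, fun x hx => ?_⟩
    simp [bspline, h_zero j le_rfl, hx.1, hx.2]
  | succ q ih =>
    have knot_pos : ∀ n, p < n → 0 < ξ n := fun n hn => h_pos.trans_le (hξ hn)
    have h_left : ∃ g : ℝ → ℝ, Continuous g ∧ 0 ≤ g 0 ∧ (0 < i → 0 < g 0) ∧
        ∀ x ∈ Set.Ico 0 (ξ (p + 1)), (if ξ (j + q + 1) = ξ j then 0
          else (x - ξ j) / (ξ (j + q + 1) - ξ j) * bspline ξ q j x) = x ^ i * g x := by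
      rcases i with _ | i
      · refine ⟨fun _ => 0, continuous_const, le_rfl, by simp, fun x _ => ?_⟩
        simp [h_zero j hj, h_zero (j + q + 1) (by omega)]
      · obtain ⟨g, hgc, hg0, hg⟩ := ih j i hj (by omega)
        have hk := knot_pos (j + q + 1) (by omega)
        refine ⟨fun x => g x / ξ (j + q + 1), by fun_prop, (div_pos hg0 hk).le,
          fun _ => div_pos hg0 hk, fun x hx => ?_⟩
        rw [hg x hx, h_zero j hj, if_neg hk.ne']
        ring
    have h_right : ∃ g : ℝ → ℝ, Continuous g ∧ 0 ≤ g 0 ∧ (i = 0 → 0 < g 0) ∧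
        ∀ x ∈ Set.Ico 0 (ξ (p + 1)), (if ξ (j + q + 2) = ξ (j + 1) then 0
          else (ξ (j + q + 2) - x) / (ξ (j + q + 2) - ξ (j + 1)) * bspline ξ q (j + 1) x)
            = x ^ i * g x := by
      rcases hj.eq_or_lt with rfl | hj
      · refine ⟨fun _ => 0, continuous_const, le_rfl, by omega, fun x hx => ?_⟩
        simp [bspline_eq_zero_of_lt hξ q (j + 1) hx.2]
      · obtain ⟨g, hgc, hg0, hg⟩ := ih (j + 1) i hj (by omega)
        have hk := knot_pos (j + q + 2) (by omega)
        have h0 : 0 < (ξ (j + q + 2) - 0) / ξ (j + q + 2) * g 0 := by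
          rw [sub_zero]
          positivity
        refine ⟨fun x => (ξ (j + q + 2) - x) / ξ (j + q + 2) * g x, by fun_prop, h0.le,
          fun _ => h0, fun x hx => ?_⟩
        rw [hg x hx, h_zero (j + 1) hj, if_neg hk.ne']
        ring
    obtain ⟨g₁, hc₁, hn₁, hp₁, hg₁⟩ := h_left
    obtain ⟨g₂, hc₂, hn₂, hp₂, hg₂⟩ := h_right
    refine ⟨fun x => g₁ x + g₂ x, hc₁.add hc₂, ?_, fun x hx => ?_⟩
    · rcases i.eq_zero_or_pos with h | h
      · exact add_pos_of_nonneg_of_pos hn₁ (hp₂ h)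
      · exact add_pos_of_pos_of_nonneg (hp₁ h) hn₂
    · rw [bspline, hg₁ x hx, hg₂ x hx, mul_add]

/-- If `ξ` vanishes up to index `p` and increases strictly from there up to index `N`, then the
B-splines `b_0^p, …, b_{N-1}^p` are linearly independent on `[0, ξ_N)`. -/
theorem linearIndependent_bspline {ξ : ℕ → ℝ} (hξ : Monotone ξ) {p N : ℕ} (hpN : p < N)
    (h_zero : ∀ i ≤ p, ξ i = 0) (h_lt : ∀ i, p ≤ i → i < N → ξ i < ξ (i + 1)) :
    LinearIndependent ℝ
      (fun j : Fin N => (Set.Ico (0 : ℝ) (ξ N)).domRestrict (bspline ξ p j)) := by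
  have h_pos : 0 < ξ (p + 1) := h_zero p le_rfl ▸ h_lt p le_rfl hpN
  rw [Fintype.linearIndependent_iff]
  intro c hc
  have hsum : ∀ x ∈ Set.Ico (0 : ℝ) (ξ N), ∑ j : Fin N, c j * bspline ξ p j x = 0 := by
    intro x hx
    simpa [Finset.sum_apply] using congrFun hc ⟨x, hx⟩
  intro n
  induction n using WellFoundedLT.induction with
  | ind n ih =>
    rcases le_or_gt (n : ℕ) p with hn | hn
    · have h_factor : ∀ j : Fin N, ∃ g : ℝ → ℝ, Continuous g ∧ ((j : ℕ) ≤ p → 0 < g 0) ∧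
          ∀ x ∈ Set.Ico 0 (ξ (p + 1)), bspline ξ p j x = x ^ (j : ℕ) * g x := by
        intro j
        rcases le_or_gt (j : ℕ) p with hj | hj
        · obtain ⟨g, hgc, hg0, hg⟩ :=
            exists_bspline_eq_pow_mul hξ h_zero h_pos p j j hj (add_comm _ _)
          exact ⟨g, hgc, fun _ => hg0, hg⟩
        · refine ⟨fun _ => 0, continuous_const, by omega, fun x hx => ?_⟩
          simp [bspline_eq_zero_of_lt hξ p j (hx.2.trans_le (hξ hj))]
      choose g hgc hg0 hg using h_factor
      let G : ℝ → ℝ := fun x => ∑ j : Fin N, c j * (x ^ ((j : ℕ) - n) * g j x)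
      have hGc : Continuous G := by fun_prop
      have hG : ∀ x ∈ Set.Ioo 0 (ξ (p + 1)), G x = 0 := by
        intro x hx
        have h := hsum x ⟨hx.1.le, hx.2.trans_le (hξ hpN)⟩
        have hmul : x ^ (n : ℕ) * G x = ∑ j : Fin N, c j * bspline ξ p j x := by
          rw [Finset.mul_sum]
          refine Finset.sum_congr rfl fun j _ => ?_
          rcases lt_or_ge j n with hj | hj
          · simp [ih j hj]
          · rw [hg j x ⟨hx.1.le, hx.2⟩, ← pow_mul_pow_sub x (Fin.le_def.1 hj)]
            ring
        rw [h] at hmul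
        exact (mul_eq_zero.1 hmul).resolve_left (pow_ne_zero _ hx.1.ne')
      have hG0 : G 0 = 0 := by
        have h : Set.EqOn G (fun _ => 0) (closure (Set.Ioo 0 (ξ (p + 1)))) :=
          Set.EqOn.closure hG hGc continuous_const
        rw [closure_Ioo h_pos.ne] at h
        exact h ⟨le_rfl, h_pos.le⟩
      have hGn : G 0 = c n * g n 0 := by
        refine (Finset.sum_eq_single n (fun j _ hj => ?_) (by simp)).trans (by simp)
        rcases lt_or_gt_of_ne hj with hj | hj
        · simp [ih j hj]
        · simp [Nat.sub_ne_zero_of_lt (Fin.lt_def.1 hj)]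
      exact (mul_eq_zero.1 (hGn.symm.trans hG0)).resolve_right (hg0 n hn).ne'
    · obtain ⟨x, hx⟩ := exists_between (h_lt n hn.le n.2)
      have h0 : 0 ≤ x := (h_zero 0 p.zero_le ▸ hξ (Nat.zero_le n)).trans hx.1.le
      have h := hsum x ⟨h0, hx.2.trans_le (hξ n.2)⟩
      rw [Finset.sum_eq_single n (fun j _ hj => ?_) (by simp)] at h
      · exact (mul_eq_zero.1 h).resolve_right (bspline_pos_of_mem_Ioo hξ p n hx).ne'
      · rcases lt_or_gt_of_ne hj with hj | hj
        · simp [ih j hj]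
        · simp [bspline_eq_zero_of_lt hξ p j (hx.2.trans_le (hξ (Fin.lt_def.1 hj)))]

theorem uniformKnots_of_le {p m i : ℕ} (hi : i ≤ p) : uniformKnots p m i = 0 := if_pos hi

theorem uniformKnots_of_ge {p m i : ℕ} (hi : 2 ^ m + p ≤ i) : uniformKnots p m i = 1 := by
  have : 0 < 2 ^ m := by positivity
  rw [uniformKnots, if_neg (by omega), if_pos hi]

theorem uniformKnots_of_mem_Icc {p m i : ℕ} (hp : p ≤ i) (hi : i ≤ 2 ^ m + p) :
    uniformKnots p m i = ((i : ℝ) - p) / 2 ^ m := by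
  rcases hp.eq_or_lt with rfl | hp
  · simp [uniformKnots]
  rcases hi.eq_or_lt with rfl | hi
  · simp [uniformKnots_of_ge]
  · rw [uniformKnots, if_neg hp.not_ge, if_neg hi.not_ge]

theorem uniformKnots_lt_succ {p m i : ℕ} (hp : p ≤ i) (hi : i < 2 ^ m + p) :
    uniformKnots p m i < uniformKnots p m (i + 1) := by
  rw [uniformKnots_of_mem_Icc hp hi.le, uniformKnots_of_mem_Icc (by omega) hi]
  push_cast
  gcongr
  linarith

theorem uniformKnots_monotone (p m : ℕ) : Monotone (uniformKnots p m) := by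
  refine monotone_nat_of_le_succ fun i => ?_
  rcases lt_or_ge i p with hp | hp
  · rw [uniformKnots_of_le hp.le, uniformKnots_of_le hp]
  rcases lt_or_ge i (2 ^ m + p) with hi | hi
  · exact (uniformKnots_lt_succ hp hi).le
  · rw [uniformKnots_of_ge hi, uniformKnots_of_ge (by omega)]

/-- The `2^m + p` B-spline basis functions of degree `p` associated with the
uniform knot vector `Ξ_{p,m}` are linearly independent as functions on `[0,1)`;
in particular, the spline space `S_p(Ξ_{p,m})` they span has dimension
`2^m + p`. -/
theorem bspline_uniform_linearIndependent (p m : ℕ) :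
    LinearIndependent ℝ
      (fun j : Fin (2 ^ m + p) =>
        (Set.Ico (0 : ℝ) 1).restrict (bspline (uniformKnots p m) p j)) ∧
    Module.finrank ℝ
      ↥(Submodule.span ℝ (Set.range (fun j : Fin (2 ^ m + p) =>
          (Set.Ico (0 : ℝ) 1).restrict (bspline (uniformKnots p m) p j))))
        = 2 ^ m + p := by
  have h := linearIndependent_bspline (uniformKnots_monotone p m)
    (Nat.lt_add_of_pos_left (by positivity : 0 < 2 ^ m)) (fun _ => uniformKnots_of_le)
    (fun _ => uniformKnots_lt_succ)
  rw [uniformKnots_of_ge le_rfl] at h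
  exact ⟨h, (finrank_span_eq_card h).trans (Fintype.card_fin _)⟩
end
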